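/- Let α be a real number with 3/4 < α ≤ 1, σ ∈ {−1, +1}, let 2 − 2α ≤ s' < s, R > 0 and ε > 0, and let A be a subset of {u : ‖u‖_{H^s} ≤ R}. There exists N₀ ∈ ℕ, depending only on α, s, s', ε, R, such that for every N ≥ N₀ the following holds: if for every u₀ ∈ A the truncated Birkhoff flow Φ_t^N(u₀) exists for all t ∈ [−1,1] and satisfies sup_{t∈[−1,1]} sup_{u₀∈A} ‖Φ_t^N(u₀)‖_{H^s} ≤ R, then for every u₀ ∈ A the untruncated flow Φ_t(u₀) is well defined for all t ∈ [−1,1], and sup_{t∈[−1,1]} ‖Φ_t(u₀) − Φ_t^N(u₀)‖_{H^{s'}} ≤ ε. -/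

import Mathlib

open scoped BigOperators ENNReal ComplexConjugate Classical
open Filter Set MeasureTheory ComplexConjugate

noncomputable section

/-- `ℝ≥0∞`-valued `H^s` norm of a sequence of Fourier coefficients. -/
def hsE (s : ℝ) (u : ℤ → ℂ) : ℝ≥0∞ :=
  (∑' n : ℤ, ENNReal.ofReal (1 + |(n : ℝ)| ^ (2 * s)) * (‖u n‖₊ : ℝ≥0∞) ^ 2) ^ ((1:ℝ)/2)

/-- `ℝ≥0∞`-valued `FL^{0,1}` norm. -/
def flE (u : ℤ → ℂ) : ℝ≥0∞ := ∑' n : ℤ, (‖u n‖₊ : ℝ≥0∞)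

/-- real-valued `H^s` norm. -/
def hsR (s : ℝ) (u : ℤ → ℂ) : ℝ :=
  Real.sqrt (∑' n : ℤ, (1 + |(n : ℝ)| ^ (2 * s)) * ‖u n‖ ^ 2)

/-- real-valued `FL^{0,1}` norm. -/
def flR (u : ℤ → ℂ) : ℝ := ∑' n : ℤ, ‖u n‖

/-- The condition `|j| ≤ N` for `N ∈ ℕ ∪ {∞}`. -/
def inBall (N : ℕ∞) (j : ℤ) : Prop := (j.natAbs : ℕ∞) ≤ N

/-- The resonance function `Φ_α`. -/
def res (α : ℝ) (j₁ j₂ j₃ : ℤ) : ℝ :=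
  |(j₁ : ℝ)| ^ (2 * α) + |(j₂ : ℝ)| ^ (2 * α) - |(j₃ : ℝ)| ^ (2 * α)
    - |((j₁ + j₂ - j₃ : ℤ) : ℝ)| ^ (2 * α)

/-- The (truncated) Birkhoff vector field `X_N`. -/
def XB (α σ : ℝ) (N : ℕ∞) (u : ℤ → ℂ) : ℤ → ℂ := fun n =>
  if inBall N n then
    ∑' p : ℤ × ℤ,
      (if inBall N p.1 ∧ inBall N p.2 ∧ inBall N (p.1 + p.2 - n) ∧
          res α p.1 p.2 (p.1 + p.2 - n) ≠ 0 then
        ((-σ / res α p.1 p.2 (p.1 + p.2 - n) : ℝ) : ℂ) *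
          (u p.1 * u p.2 * conj (u (p.1 + p.2 - n)))
      else 0)
  else 0

/-- Truncation `Π_N`. -/
def trunc (N : ℕ) (u : ℤ → ℂ) : ℤ → ℂ := fun n => if n.natAbs ≤ N then u n else 0

/-- Derivative of a curve at `t`, in the `H^s` norm. -/
def HasHsDerivAt (s : ℝ) (u : ℝ → ℤ → ℂ) (d : ℤ → ℂ) (t : ℝ) : Prop :=
  Tendsto (fun h : ℝ => hsE s (fun n => (u (t + h) n - u t n) / (h : ℂ) - d n))
    (nhdsWithin 0 {(0 : ℝ)}ᶜ) (nhds 0)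

/-- Derivative of a curve at `t` within a set `A` of times, in the `H^s` norm. -/
def HasHsDerivWithinAt (s : ℝ) (u : ℝ → ℤ → ℂ) (d : ℤ → ℂ) (A : Set ℝ) (t : ℝ) : Prop :=
  Tendsto (fun h : ℝ => hsE s (fun n => (u (t + h) n - u t n) / (h : ℂ) - d n))
    (nhdsWithin 0 {h : ℝ | t + h ∈ A ∧ h ≠ 0}) (nhds 0)

/-- Continuity of a curve in the `H^s` norm. -/
def ContHs (s : ℝ) (D : ℝ → ℤ → ℂ) : Prop :=
  ∀ t : ℝ, Tendsto (fun t' => hsE s (fun n => D t' n - D t n)) (nhds t) (nhds 0)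

/-- Continuity of a curve in the `H^s` norm, on a set of times. -/
def ContHsOn (s : ℝ) (A : Set ℝ) (D : ℝ → ℤ → ℂ) : Prop :=
  ∀ t ∈ A, Tendsto (fun t' => hsE s (fun n => D t' n - D t n)) (nhdsWithin t A) (nhds 0)

/-- `u` is a global-in-time solution of `d/dt u = X_N(u)`, as a curve in `H^s`. -/
def IsSol (α σ : ℝ) (N : ℕ∞) (s : ℝ) (u : ℝ → ℤ → ℂ) : Prop :=
  ∀ t : ℝ, hsE s (u t) ≠ ⊤ ∧ HasHsDerivAt s u (XB α σ N (u t)) t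

/-- `u` solves `d/dt u = X_N(u)` on the set of times `A`, as a curve in `H^s`. -/
def IsSolOn (α σ : ℝ) (N : ℕ∞) (s : ℝ) (A : Set ℝ) (u : ℝ → ℤ → ℂ) : Prop :=
  ∀ t ∈ A, hsE s (u t) ≠ ⊤ ∧ HasHsDerivWithinAt s u (XB α σ N (u t)) A t

/-- `u` is a global-in-time continuously differentiable solution, as a curve in `H^s`. -/
def IsC1Sol (α σ : ℝ) (N : ℕ∞) (s : ℝ) (u : ℝ → ℤ → ℂ) : Prop :=
  IsSol α σ N s u ∧ ContHs s (fun t => XB α σ N (u t))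

/-- `u` is a continuously differentiable solution on the set of times `A`. -/
def IsC1SolOn (α σ : ℝ) (N : ℕ∞) (s : ℝ) (A : Set ℝ) (u : ℝ → ℤ → ℂ) : Prop :=
  IsSolOn α σ N s A u ∧ ContHsOn s A (fun t => XB α σ N (u t))

/-- integer modes in `[-N, N]`. -/
def Ifin (N : ℕ) : Finset ℤ := Finset.Icc (-(N:ℤ)) (N:ℤ)

/-- The quartic form `‖Π_N u‖⁴_{L⁴}`. -/
def qL4 (N : ℕ) (u : ℤ → ℂ) : ℝ :=
  (∑ j₁ ∈ Ifin N, ∑ j₂ ∈ Ifin N, ∑ j₃ ∈ Ifin N, ∑ j₄ ∈ Ifin N,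
    if j₁ + j₂ = j₃ + j₄ then u j₁ * u j₂ * conj (u j₃) * conj (u j₄) else 0).re

/-- `G_N(u)`, the derivative at `t = 0` of the energy along the truncated Birkhoff flow. -/
def GN (α σ : ℝ) (N : ℕ) (u : ℤ → ℂ) : ℝ :=
  -(σ/2) * qL4 N u + σ * (∑ j ∈ Ifin N, ‖u j‖^2)^2
  + 2 * σ * (∑ n₁ ∈ Ifin N, ∑ n₂ ∈ Ifin N, ∑ m₁ ∈ Ifin N, ∑ m₂ ∈ Ifin N,
      if n₁ + n₂ = m₁ + m₂ then
        XB α σ (N : ℕ∞) (trunc N u) n₁ * u n₂ * conj (u m₁) * conj (u m₂)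
      else 0).re

lemma ConvexOn.add_le_add_of_add_eq {S : Set ℝ} {g : ℝ → ℝ} (hg : ConvexOn ℝ S g) {p q r t : ℝ}
    (hp : p ∈ S) (ht : t ∈ S) (hpq : p ≤ q) (hpr : p ≤ r) (h : q + r = p + t) :
    g q + g r ≤ g p + g t := by
  rcases (show p ≤ t by linarith).eq_or_lt with hpt | hpt
  · obtain rfl : q = p := by linarith
    obtain rfl : r = t := by linarith
    rfl
  · have hd : 0 < t - p := by linarith
    have key : ∀ x, p ≤ x → x ≤ t → (t - p) * g x ≤ (t - x) * g p + (x - p) * g t := by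
      intro x h1 h2
      rcases h1.eq_or_lt with rfl | h1
      · linarith
      rcases h2.eq_or_lt with rfl | h2
      · linarith
      exact hg.secant_mono_aux1 hp ht h1 h2
    have h1 := key q hpq (by linarith)
    have h2 := key r hpr (by linarith)
    obtain rfl : r = p + t - q := by linarith
    refine le_of_mul_le_mul_left ?_ hd
    linarith

lemma convexOn_abs_rpow_sub_sq {α M : ℝ} (hα₁ : 1 / 2 < α) (hα₂ : α ≤ 1) :
    ConvexOn ℝ (Icc (-M) M)
      (fun x : ℝ => |x| ^ (2 * α) - α * (2 * α - 1) * M ^ (2 * α - 2) * |x| ^ 2) := by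
  set k : ℝ := α * (2 * α - 1) * M ^ (2 * α - 2) with hk
  have hpow : ∀ x ∈ Ioo (0 : ℝ) M, M ^ (2 * α - 2) ≤ x ^ (2 * α - 2) := fun x hx =>
    Real.rpow_le_rpow_of_nonpos hx.1 hx.2.le (by linarith)
  have hd1 : ∀ x ∈ Ioo (0 : ℝ) M,
      HasDerivAt (fun x : ℝ => x ^ (2 * α) - k * x ^ 2)
        (2 * α * x ^ (2 * α - 1) - k * (2 * x)) x := by
    intro x hx
    have := ((Real.hasDerivAt_rpow_const (p := 2 * α) (Or.inl hx.1.ne'))).fun_sub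
      ((hasDerivAt_pow 2 x).const_mul k)
    simpa using this
  have hd2 : ∀ x ∈ Ioo (0 : ℝ) M,
      HasDerivAt (fun x : ℝ => 2 * α * x ^ (2 * α - 1) - k * (2 * x))
        (2 * α * ((2 * α - 1) * x ^ (2 * α - 2)) - k * 2) x := by
    intro x hx
    have h1 := (Real.hasDerivAt_rpow_const (x := x) (p := 2 * α - 1) (Or.inl hx.1.ne')).const_mul
      (2 * α)
    have h2 := (((hasDerivAt_id x).const_mul 2).const_mul k)
    have := h1.fun_sub h2
    rw [show 2 * α - 1 - 1 = 2 * α - 2 by ring] at this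
    simpa using this
  have hc : ContinuousOn (fun x : ℝ => x ^ (2 * α) - k * x ^ 2) (Icc 0 M) := by
    refine ContinuousOn.sub ?_ (by fun_prop)
    exact (Real.continuous_rpow_const (by linarith)).continuousOn
  have hconv : ConvexOn ℝ (Icc 0 M) (fun x : ℝ => x ^ (2 * α) - k * x ^ 2) := by
    refine convexOn_of_hasDerivWithinAt2_nonneg (convex_Icc 0 M) hc
      (f' := fun x => 2 * α * x ^ (2 * α - 1) - k * (2 * x))
      (f'' := fun x => 2 * α * ((2 * α - 1) * x ^ (2 * α - 2)) - k * 2) ?_ ?_ ?_ <;>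
      rw [interior_Icc] <;> intro x hx
    · exact (hd1 x hx).hasDerivWithinAt
    · exact (hd2 x hx).hasDerivWithinAt
    · have := mul_le_mul_of_nonneg_left (hpow x hx)
        (show 0 ≤ 2 * α * (2 * α - 1) by nlinarith)
      rw [hk]; linarith
  have hmono : MonotoneOn (fun x : ℝ => x ^ (2 * α) - k * x ^ 2) (Icc 0 M) := by
    refine monotoneOn_of_hasDerivWithinAt_nonneg (convex_Icc 0 M) hc
      (f' := fun x => 2 * α * x ^ (2 * α - 1) - k * (2 * x)) ?_ ?_ <;>
      rw [interior_Icc] <;> intro x hx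
    · exact (hd1 x hx).hasDerivWithinAt
    · have h1 : x ^ (2 * α - 1) = x ^ (2 * α - 2) * x := by
        rw [← Real.rpow_add_one hx.1.ne']; congr 1; ring
      have h2 := mul_le_mul_of_nonneg_right (hpow x hx) hx.1.le
      have h3 : 0 ≤ M ^ (2 * α - 2) * x :=
        mul_nonneg (Real.rpow_nonneg (hx.1.le.trans hx.2.le) _) hx.1.le
      have h4 : 2 * α * (M ^ (2 * α - 2) * x) ≤ 2 * α * (x ^ (2 * α - 2) * x) :=
        mul_le_mul_of_nonneg_left h2 (by linarith)
      have h5 : (2 * α - 1) * (2 * α * (M ^ (2 * α - 2) * x)) ≤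
          1 * (2 * α * (M ^ (2 * α - 2) * x)) :=
        mul_le_mul_of_nonneg_right (by linarith) (mul_nonneg (by linarith) h3)
      rw [h1, hk]; linarith
  refine ⟨convex_Icc _ _, ?_⟩
  intro x hx y hy a b ha hb hab
  have hx' : |x| ∈ Icc 0 M := ⟨abs_nonneg x, abs_le.2 hx⟩
  have hy' : |y| ∈ Icc 0 M := ⟨abs_nonneg y, abs_le.2 hy⟩
  have hxy := convex_Icc (-M) M hx hy ha hb hab
  refine (hmono ⟨abs_nonneg _, abs_le.2 hxy⟩ (convex_Icc 0 M hx' hy' ha hb hab) ?_).trans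
    (hconv.2 hx' hy' ha hb hab)
  simp only [smul_eq_mul]
  exact (abs_add_le _ _).trans_eq (by rw [abs_mul, abs_mul, abs_of_nonneg ha, abs_of_nonneg hb])

/-- Quantitative non-degeneracy of the resonance function. -/
lemma le_abs_rpow_add_sub {α M : ℝ} (hα₁ : 1 / 2 < α) (hα₂ : α ≤ 1) {x₁ x₂ x₃ x₄ : ℝ}
    (h₁ : |x₁| ≤ M) (h₂ : |x₂| ≤ M) (h₃ : |x₃| ≤ M) (h₄ : |x₄| ≤ M) (h : x₁ + x₂ = x₃ + x₄) :
    2 * α * (2 * α - 1) * M ^ (2 * α - 2) * (|x₁ - x₃| * |x₂ - x₃|) ≤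
      |(|x₁| ^ (2 * α) + |x₂| ^ (2 * α) - |x₃| ^ (2 * α) - |x₄| ^ (2 * α))| := by
  have hg := convexOn_abs_rpow_sub_sq (M := M) hα₁ hα₂
  set k : ℝ := α * (2 * α - 1) * M ^ (2 * α - 2) with hk
  rw [abs_le] at h₁ h₂ h₃ h₄
  obtain rfl : x₄ = x₁ + x₂ - x₃ := by linarith
  rw [← abs_mul, show 2 * α * (2 * α - 1) * M ^ (2 * α - 2) = 2 * k by rw [hk]; ring]
  have i1 := fun a b c d => hg.add_le_add_of_add_eq (p := x₃) (q := x₁) (r := x₂)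
    (t := x₁ + x₂ - x₃) a b c d (by ring)
  have i2 := fun a b c d => hg.add_le_add_of_add_eq (p := x₁ + x₂ - x₃) (q := x₁) (r := x₂)
    (t := x₃) a b c d (by ring)
  have i3 := fun a b c d => hg.add_le_add_of_add_eq (p := x₁) (q := x₃) (r := x₁ + x₂ - x₃)
    (t := x₂) a b c d (by ring)
  have i4 := fun a b c d => hg.add_le_add_of_add_eq (p := x₂) (q := x₃) (r := x₁ + x₂ - x₃)
    (t := x₁) a b c d (by ring)
  simp only [sq_abs] at i1 i2 i3 i4
  rcases le_total x₃ x₁ with ha | ha <;> rcases le_total x₃ x₂ with hb | hb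
  · have := i1 h₃ h₄ ha hb
    rw [abs_of_nonneg (mul_nonneg (by linarith) (by linarith)), le_abs]
    right; linarith
  · have := i4 h₂ h₁ hb (by linarith)
    rw [abs_of_nonpos (mul_nonpos_of_nonneg_of_nonpos (by linarith) (by linarith)), le_abs]
    left; linarith
  · have := i3 h₁ h₂ ha (by linarith)
    rw [abs_of_nonpos (mul_nonpos_of_nonpos_of_nonneg (by linarith) (by linarith)), le_abs]
    left; linarith
  · have := i2 h₄ h₃ (by linarith) (by linarith)
    rw [abs_of_nonneg (mul_nonneg_of_nonpos_of_nonpos (by linarith) (by linarith)), le_abs]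
    right; linarith

lemma ENNReal.tsum_mul_sq_le {ι : Type*} (f g : ι → ℝ≥0∞) :
    (∑' i, f i * g i) ^ 2 ≤ (∑' i, f i ^ 2) * ∑' i, g i ^ 2 := by
  let _ : MeasurableSpace ι := ⊤
  have h := ENNReal.lintegral_mul_le_Lp_mul_Lq (Measure.count : Measure ι)
    Real.HolderConjugate.two_two (f := f) (g := g) measurable_from_top.aemeasurable
    measurable_from_top.aemeasurable
  simp only [Pi.mul_apply, lintegral_count, ENNReal.rpow_two] at h
  have h2 := pow_le_pow_left' h 2
  rwa [mul_pow, ← ENNReal.rpow_two, ← ENNReal.rpow_two, ← ENNReal.rpow_two, ← ENNReal.rpow_mul,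
    ← ENNReal.rpow_mul, one_div, inv_mul_cancel₀ two_ne_zero, ENNReal.rpow_one,
    ENNReal.rpow_one, ENNReal.rpow_two] at h2

lemma ENNReal.tsum_prod_mul {ι κ : Type*} (f : ι → ℝ≥0∞) (g : κ → ℝ≥0∞) :
    ∑' p : ι × κ, f p.1 * g p.2 = (∑' i, f i) * ∑' j, g j := by
  rw [ENNReal.tsum_prod (f := fun i j => f i * g j)]
  simp_rw [ENNReal.tsum_mul_left, ENNReal.tsum_mul_right]

/-- The Hilbert space of square-summable sequences. -/
abbrev Ell2 : Type := lp (fun _ : ℤ => ℂ) 2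

lemma memℓp_two_iff {f : ℤ → ℂ} : Memℓp f 2 ↔ ∑' n, ‖f n‖ₑ ^ 2 ≠ ⊤ := by
  have h : ∀ n, ‖f n‖ₑ ^ 2 = ((‖f n‖₊ ^ 2 : NNReal) : ℝ≥0∞) := fun n => by
    rw [ENNReal.coe_pow]; rfl
  simp_rw [h]
  rw [ENNReal.tsum_coe_ne_top_iff_summable, memℓp_gen_iff (by simp), ← NNReal.summable_coe]
  simp

lemma enorm_sq_eq_tsum (x : Ell2) : ‖x‖ₑ ^ 2 = ∑' n, ‖x n‖ₑ ^ 2 := by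
  have hs := lp.hasSum_norm (by simp) x
  simp only [ENNReal.toReal_ofNat, Real.rpow_ofNat] at hs
  rw [← ofReal_norm, ← ENNReal.ofReal_pow (norm_nonneg _), ← hs.tsum_eq,
    ENNReal.ofReal_tsum_of_nonneg (fun _ => by positivity) hs.summable]
  refine tsum_congr fun n => ?_
  rw [ENNReal.ofReal_pow (norm_nonneg _), ofReal_norm]

/-- The trilinear expression with kernel `κ`. -/
def triSum (κ : ℤ → ℤ × ℤ → ℂ) (x y z : ℤ → ℂ) (n : ℤ) : ℂ :=
  ∑' p : ℤ × ℤ, κ n p * (x p.1 * y p.2 * conj (z (p.1 + p.2 - n)))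

/-- The kernel `κ` is dominated by `C` times a tensor square of `h`. -/
def KernelBound (κ : ℤ → ℤ × ℤ → ℂ) (C : ℝ≥0∞) (h : ℤ → ℝ≥0∞) : Prop :=
  ∀ n p, ‖κ n p‖ₑ ≤ C * (h (n - p.1) * h (n - p.2))

lemma tsum_tsum_enorm_sq_le {κ : ℤ → ℤ × ℤ → ℂ} {C : ℝ≥0∞} {h : ℤ → ℝ≥0∞}
    (hκ : KernelBound κ C h) (x y z : ℤ → ℂ) :
    ∑' n, (∑' p : ℤ × ℤ, ‖κ n p * (x p.1 * y p.2 * conj (z (p.1 + p.2 - n)))‖ₑ) ^ 2 ≤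
      (C * ∑' a, h a ^ 2) ^ 2 *
        ((∑' n, ‖x n‖ₑ ^ 2) * (∑' n, ‖y n‖ₑ ^ 2) * ∑' n, ‖z n‖ₑ ^ 2) := by
  set G := ∑' a, h a ^ 2 with hG
  have hsum : ∀ n : ℤ, ∑' p : ℤ × ℤ, (C * (h (n - p.1) * h (n - p.2))) ^ 2 = (C * G) ^ 2 := by
    intro n
    simp_rw [mul_pow]
    rw [ENNReal.tsum_mul_left,
      ENNReal.tsum_prod_mul (fun a => h (n - a) ^ 2) (fun a => h (n - a) ^ 2)]
    have := (Equiv.subLeft n).tsum_eq (fun a => h a ^ 2)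
    simp only [Equiv.subLeft_apply] at this
    rw [this, ← hG, sq G]
  have hn : ∀ n : ℤ,
      (∑' p : ℤ × ℤ, ‖κ n p * (x p.1 * y p.2 * conj (z (p.1 + p.2 - n)))‖ₑ) ^ 2 ≤
      (C * G) ^ 2 * ∑' p : ℤ × ℤ,
        (‖x p.1‖ₑ ^ 2 * ‖y p.2‖ₑ ^ 2) * ‖z (p.1 + p.2 - n)‖ₑ ^ 2 := by
    intro n
    rw [← hsum n]
    simp_rw [← mul_pow]
    refine le_trans ?_ (ENNReal.tsum_mul_sq_le _ _)
    gcongr with p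
    rw [enorm_mul, enorm_mul, enorm_mul, RCLike.enorm_conj]
    gcongr
    exact hκ n p
  refine (ENNReal.tsum_le_tsum hn).trans_eq ?_
  rw [ENNReal.tsum_mul_left, ENNReal.tsum_comm]
  simp_rw [ENNReal.tsum_mul_left]
  have hz : ∀ p : ℤ × ℤ, ∑' n, ‖z (p.1 + p.2 - n)‖ₑ ^ 2 = ∑' n, ‖z n‖ₑ ^ 2 := fun p => by
    simpa using (Equiv.subLeft (p.1 + p.2)).tsum_eq (fun a => ‖z a‖ₑ ^ 2)
  simp_rw [hz]
  rw [ENNReal.tsum_mul_right, ENNReal.tsum_prod_mul (fun a => ‖x a‖ₑ ^ 2) (fun a => ‖y a‖ₑ ^ 2)]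

section Trilinear

variable {κ : ℤ → ℤ × ℤ → ℂ} {C : ℝ≥0∞} {h : ℤ → ℝ≥0∞}

lemma tsum_tsum_enorm_sq_lt_top (hC : C ≠ ⊤) (hh : ∑' a, h a ^ 2 ≠ ⊤) (hκ : KernelBound κ C h)
    (x y z : Ell2) :
    ∑' n, (∑' p : ℤ × ℤ, ‖κ n p * (x p.1 * y p.2 * conj (z (p.1 + p.2 - n)))‖ₑ) ^ 2 < ⊤ := by
  refine (tsum_tsum_enorm_sq_le hκ x y z).trans_lt ?_
  rw [← enorm_sq_eq_tsum, ← enorm_sq_eq_tsum, ← enorm_sq_eq_tsum]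
  finiteness

lemma summable_triSum (hC : C ≠ ⊤) (hh : ∑' a, h a ^ 2 ≠ ⊤) (hκ : KernelBound κ C h)
    (x y z : Ell2) (n : ℤ) :
    Summable fun p : ℤ × ℤ => κ n p * (x p.1 * y p.2 * conj (z (p.1 + p.2 - n))) := by
  have h1 := ENNReal.ne_top_of_tsum_ne_top (tsum_tsum_enorm_sq_lt_top hC hh hκ x y z).ne n
  have h2 : ∑' p : ℤ × ℤ, ‖κ n p * (x p.1 * y p.2 * conj (z (p.1 + p.2 - n)))‖ₑ ≠ ⊤ :=
    fun h => h1 (by rw [h]; rfl)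
  exact Summable.of_norm (tsum_enorm_ne_top_iff_summable_norm.1 h2)

lemma tsum_triSum_le (hκ : KernelBound κ C h) (x y z : Ell2) :
    ∑' n, ‖triSum κ x y z n‖ₑ ^ 2 ≤ (C * (∑' a, h a ^ 2) * (‖x‖ₑ * ‖y‖ₑ * ‖z‖ₑ)) ^ 2 := by
  rw [mul_pow, mul_pow (‖x‖ₑ * ‖y‖ₑ), mul_pow ‖x‖ₑ, enorm_sq_eq_tsum, enorm_sq_eq_tsum,
    enorm_sq_eq_tsum]
  refine le_trans ?_ (tsum_tsum_enorm_sq_le hκ x y z)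
  gcongr
  exact enorm_tsum_le_tsum_enorm

lemma memℓp_triSum (hC : C ≠ ⊤) (hh : ∑' a, h a ^ 2 ≠ ⊤) (hκ : KernelBound κ C h)
    (x y z : Ell2) : Memℓp (triSum κ x y z) 2 := by
  refine memℓp_two_iff.2 (ne_top_of_le_ne_top ?_ (tsum_triSum_le hκ x y z))
  finiteness

lemma norm_triSum_le (hC : C ≠ ⊤) (hh : ∑' a, h a ^ 2 ≠ ⊤) (hκ : KernelBound κ C h)
    (x y z w : Ell2) (hw : ⇑w = triSum κ x y z) :
    ‖w‖ ≤ (C * ∑' a, h a ^ 2).toReal * (‖x‖ * ‖y‖ * ‖z‖) := by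
  have h1 : ‖w‖ₑ ^ 2 ≤ (C * (∑' a, h a ^ 2) * (‖x‖ₑ * ‖y‖ₑ * ‖z‖ₑ)) ^ 2 := by
    rw [enorm_sq_eq_tsum, hw]
    exact tsum_triSum_le hκ x y z
  have h2 := (ENNReal.pow_le_pow_left_iff two_ne_zero).1 h1
  have h3 := ENNReal.toReal_mono (by finiteness) h2
  simpa [ENNReal.toReal_mul] using h3

/-- The cubic map on `ℓ²` with kernel `κ`. -/
def cubic (hC : C ≠ ⊤) (hh : ∑' a, h a ^ 2 ≠ ⊤) (hκ : KernelBound κ C h) (x : Ell2) : Ell2 :=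
  ⟨triSum κ x x x, memℓp_triSum hC hh hκ x x x⟩

lemma norm_cubic_sub_le (hC : C ≠ ⊤) (hh : ∑' a, h a ^ 2 ≠ ⊤) (hκ : KernelBound κ C h)
    {x y : Ell2} {r : ℝ} (hx : ‖x‖ ≤ r) (hy : ‖y‖ ≤ r) :
    ‖cubic hC hh hκ x - cubic hC hh hκ y‖ ≤
      (C * ∑' a, h a ^ 2).toReal * (3 * r ^ 2) * ‖x - y‖ := by
  have hr : 0 ≤ r := (norm_nonneg x).trans hx
  set T : Ell2 → Ell2 → Ell2 → Ell2 := fun a b c => ⟨triSum κ a b c, memℓp_triSum hC hh hκ a b c⟩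
  have hT : cubic hC hh hκ x - cubic hC hh hκ y = T (x - y) x x + T y (x - y) x + T y y (x - y) := by
    ext n
    change triSum κ x x x n - triSum κ y y y n = triSum κ (x - y : Ell2) x x n +
      triSum κ y (x - y : Ell2) x n + triSum κ y y (x - y : Ell2) n
    have hs := fun a b c => summable_triSum hC hh hκ a b c n
    simp only [triSum]
    rw [← (hs x x x).tsum_sub (hs y y y), ← (hs (x - y) x x).tsum_add (hs y (x - y) x),
      ← ((hs (x - y) x x).add (hs y (x - y) x)).tsum_add (hs y y (x - y))]
    refine tsum_congr fun p => ?_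
    simp only [lp.coeFn_sub, Pi.sub_apply, map_sub]
    ring
  set B := (C * ∑' a, h a ^ 2).toReal
  have hB : 0 ≤ B := ENNReal.toReal_nonneg
  have b1 : ‖T (x - y) x x‖ ≤ B * (‖x - y‖ * r * r) :=
    (norm_triSum_le hC hh hκ _ _ _ _ rfl).trans (by gcongr)
  have b2 : ‖T y (x - y) x‖ ≤ B * (r * ‖x - y‖ * r) :=
    (norm_triSum_le hC hh hκ _ _ _ _ rfl).trans (by gcongr)
  have b3 : ‖T y y (x - y)‖ ≤ B * (r * r * ‖x - y‖) :=
    (norm_triSum_le hC hh hκ _ _ _ _ rfl).trans (by gcongr)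
  rw [hT]
  refine (norm_add₃_le).trans ?_
  linarith

end Trilinear

section ODE

variable {E : Type*} [NormedAddCommGroup E] [NormedSpace ℝ E]

/-- Radial retraction onto the closed ball of radius `ε`. -/
def radial (ε : ℝ) (x : E) : E := (ε / max ε ‖x‖) • x

lemma norm_radial {ε : ℝ} (hε : 0 < ε) (x : E) : ‖radial ε x‖ = ε / max ε ‖x‖ * ‖x‖ := by
  rw [radial, norm_smul, Real.norm_of_nonneg (by positivity)]

lemma norm_radial_le {ε : ℝ} (hε : 0 < ε) (x : E) : ‖radial ε x‖ ≤ ε := by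
  have hm : 0 < max ε ‖x‖ := lt_max_of_lt_left hε
  rw [norm_radial hε, div_mul_eq_mul_div, div_le_iff₀ hm]
  gcongr
  exact le_max_right _ _

lemma norm_radial_le_norm {ε : ℝ} (hε : 0 < ε) (x : E) : ‖radial ε x‖ ≤ ‖x‖ := by
  have hm : 0 < max ε ‖x‖ := lt_max_of_lt_left hε
  rw [norm_radial hε]
  refine mul_le_of_le_one_left (norm_nonneg x) ?_
  rw [div_le_one hm]
  exact le_max_left _ _

lemma radial_eq_self {ε : ℝ} (hε : 0 < ε) {x : E} (hx : ‖x‖ ≤ ε) : radial ε x = x := by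
  rw [radial, max_eq_left hx, div_self hε.ne', one_smul]

lemma norm_radial_sub_le {ε : ℝ} (hε : 0 < ε) (x y : E) :
    ‖radial ε x - radial ε y‖ ≤ 2 * ‖x - y‖ := by
  have hx : 0 < max ε ‖x‖ := lt_max_of_lt_left hε
  have hy : 0 < max ε ‖y‖ := lt_max_of_lt_left hε
  have h1 : radial ε x - radial ε y =
      (ε / max ε ‖x‖) • (x - y) + (ε / max ε ‖x‖ - ε / max ε ‖y‖) • y := by
    simp only [radial, smul_sub, sub_smul]; abel
  have h2 : ‖(ε / max ε ‖x‖) • (x - y)‖ ≤ ‖x - y‖ := by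
    rw [norm_smul, Real.norm_of_nonneg (by positivity)]
    refine mul_le_of_le_one_left (norm_nonneg _) ?_
    rw [div_le_one hx]
    exact le_max_left _ _
  have h3 : |max ε ‖x‖ - max ε ‖y‖| ≤ ‖x - y‖ := by
    rw [max_comm ε, max_comm ε]
    exact (abs_max_sub_max_le_abs _ _ _).trans (abs_norm_sub_norm_le x y)
  have h4 : ‖(ε / max ε ‖x‖ - ε / max ε ‖y‖) • y‖ ≤ ‖x - y‖ := by
    have : ε / max ε ‖x‖ - ε / max ε ‖y‖ =
        -((max ε ‖x‖ - max ε ‖y‖) * (ε / max ε ‖x‖) * (1 / max ε ‖y‖)) := by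
      field_simp; ring
    rw [norm_smul, this, norm_neg, norm_mul, norm_mul, Real.norm_eq_abs (_ - _),
      Real.norm_of_nonneg (show 0 ≤ ε / max ε ‖x‖ by positivity),
      Real.norm_of_nonneg (show 0 ≤ 1 / max ε ‖y‖ by positivity), mul_assoc]
    have h5 : 1 / max ε ‖y‖ * ‖y‖ ≤ 1 := by
      rw [one_div_mul_eq_div, div_le_one hy]; exact le_max_right _ _
    have h6 : ε / max ε ‖x‖ ≤ 1 := by
      rw [div_le_one hx]; exact le_max_left _ _
    calc _ ≤ ‖x - y‖ * 1 * 1 := by gcongr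
      _ = _ := by ring
  rw [h1]
  exact (norm_add_le _ _).trans (by linarith)

lemma norm_le_mul_exp_of_norm_deriv_le {w w' : ℝ → E} {K η : ℝ} (hK : 1 ≤ K) (hη : 0 ≤ η)
    (hw : ∀ t ∈ Icc (-1 : ℝ) 1, HasDerivWithinAt w (w' t) (Icc (-1) 1) t) (h0 : w 0 = 0)
    (hb : ∀ t ∈ Icc (-1 : ℝ) 1, ‖w' t‖ ≤ K * ‖w t‖ + η) :
    ∀ t ∈ Icc (0 : ℝ) 1, ‖w t‖ ≤ η * Real.exp K := by
  intro t ht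
  have hsub : Icc (0 : ℝ) 1 ⊆ Icc (-1) 1 := Icc_subset_Icc (by norm_num) le_rfl
  have h := norm_le_gronwallBound_of_norm_deriv_right_le (f := w) (f' := w') (δ := 0) (K := K)
    (ε := η) (a := 0) (b := 1) (fun t ht => ((hw t (hsub ht)).continuousWithinAt).mono hsub)
    (fun t ht => (hw t (hsub (Ico_subset_Icc_self ht))).mono_of_mem_nhdsWithin
      (mem_nhdsWithin_of_mem_nhds (Icc_mem_nhds (by linarith [ht.1]) ht.2)))
    (by simp [h0]) (fun t ht => hb t (hsub (Ico_subset_Icc_self ht))) t ht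
  refine h.trans ?_
  rw [gronwallBound_of_K_ne_0 (by positivity), sub_zero]
  simp only [zero_mul, zero_add]
  have h1 : Real.exp (K * t) ≤ Real.exp K := Real.exp_le_exp.2 (by nlinarith [ht.2])
  have h2 : η / K ≤ η := div_le_self hη hK
  have h3 : 0 ≤ Real.exp (K * t) - 1 := by
    have := Real.add_one_le_exp (K * t)
    have := mul_nonneg (zero_le_one.trans hK) ht.1
    linarith
  exact mul_le_mul h2 (by linarith) h3 hη

/-- An approximate solution of an autonomous ODE with locally Lipschitz right-hand side is
shadowed by an exact solution. -/
theorem exists_solution_near [CompleteSpace E] {X : E → E} {r ε η K : ℝ} (hε : 0 < ε)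
    (hK : 1 ≤ K) (hη : 0 ≤ η)
    (hX : ∀ x y, ‖x‖ ≤ r + ε → ‖y‖ ≤ r + ε → ‖X x - X y‖ ≤ K * ‖x - y‖)
    {v v' : ℝ → E} (hv : ∀ t ∈ Icc (-1 : ℝ) 1, HasDerivWithinAt v (v' t) (Icc (-1) 1) t)
    (hvr : ∀ t ∈ Icc (-1 : ℝ) 1, ‖v t‖ ≤ r)
    (hvη : ∀ t ∈ Icc (-1 : ℝ) 1, ‖X (v t) - v' t‖ ≤ η) (hηε : η * Real.exp K ≤ ε) :
    ∃ u : ℝ → E, u 0 = v 0 ∧ ∀ t ∈ Icc (-1 : ℝ) 1,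
      HasDerivWithinAt u (X (u t)) (Icc (-1) 1) t ∧ ‖u t - v t‖ ≤ ε := by
  have h00 : (0 : ℝ) ∈ Icc (-1 : ℝ) 1 := by simp
  have hr : 0 ≤ r := (norm_nonneg _).trans (hvr 0 h00)
  have hmem : ∀ t ∈ Icc (-1 : ℝ) 1, ∀ x, ‖v t + radial ε x‖ ≤ r + ε := fun t ht x =>
    (norm_add_le _ _).trans (add_le_add (hvr t ht) (norm_radial_le hε x))
  have hXc : ContinuousOn X (Metric.closedBall 0 (r + ε)) := by
    refine (LipschitzOnWith.of_dist_le_mul (K := K.toNNReal) fun x hx y hy => ?_).continuousOn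
    rw [dist_eq_norm, dist_eq_norm, Real.coe_toNNReal _ (by linarith)]
    exact hX x y (by simpa using hx) (by simpa using hy)
  have hrad : Continuous (radial ε : E → E) := by
    refine (LipschitzWith.of_dist_le_mul (K := 2) fun x y => ?_).continuous
    rw [dist_eq_norm, dist_eq_norm]
    exact norm_radial_sub_le hε x y
  have hvc : ContinuousOn v (Icc (-1) 1) := fun t ht => (hv t ht).continuousWithinAt
  set f : ℝ → E → E := fun t x => X (v t + radial ε (x - v t)) with hf
  set L : ℝ := ‖X 0‖ + K * (r + ε) with hL
  have hL0 : 0 ≤ L := by positivity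
  have hPL : IsPicardLindelof f (tmin := -1) (tmax := 1) ⟨0, h00⟩ (v 0) L.toNNReal 0 L.toNNReal
      (K * 2).toNNReal := by
    refine ⟨fun t ht => ?_, fun x _ => ?_, fun t ht x _ => ?_, ?_⟩
    · refine LipschitzOnWith.of_dist_le_mul fun x _ y _ => ?_
      rw [dist_eq_norm, dist_eq_norm, Real.coe_toNNReal _ (by linarith)]
      refine (hX _ _ (hmem t ht _) (hmem t ht _)).trans ?_
      rw [mul_assoc, add_sub_add_left_eq_sub]
      gcongr
      refine (norm_radial_sub_le hε _ _).trans_eq ?_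
      rw [sub_sub_sub_cancel_right]
    · refine hXc.comp (hvc.add (hrad.comp_continuousOn (continuousOn_const.sub hvc)))
        fun t ht => ?_
      simpa using hmem t ht _
    · rw [Real.coe_toNNReal _ hL0]
      have h1 := hX _ 0 (hmem t ht (x - v t)) (by simp; positivity)
      have h2 := hmem t ht (x - v t)
      rw [sub_zero] at h1
      calc ‖f t x‖ = ‖X 0 + (f t x - X 0)‖ := by congr 1; abel
        _ ≤ ‖X 0‖ + ‖f t x - X 0‖ := norm_add_le _ _
        _ ≤ ‖X 0‖ + K * ‖v t + radial ε (x - v t)‖ := by gcongr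
        _ ≤ L := by rw [hL]; gcongr
    · simp
  obtain ⟨u, hu0, hu⟩ := hPL.exists_eq_forall_mem_Icc_hasDerivWithinAt₀
  have hu0 : u 0 = v 0 := hu0
  have hw : ∀ t ∈ Icc (-1 : ℝ) 1,
      HasDerivWithinAt (fun t => u t - v t) (f t (u t) - v' t) (Icc (-1) 1) t :=
    fun t ht => (hu t ht).sub (hv t ht)
  have hb : ∀ t ∈ Icc (-1 : ℝ) 1, ‖f t (u t) - v' t‖ ≤ K * ‖u t - v t‖ + η := by
    intro t ht
    have h1 := hX _ (v t) (hmem t ht (u t - v t)) ((hvr t ht).trans (by linarith))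
    rw [add_sub_cancel_left] at h1
    calc ‖f t (u t) - v' t‖ = ‖(f t (u t) - X (v t)) + (X (v t) - v' t)‖ := by
          congr 1; abel
      _ ≤ ‖f t (u t) - X (v t)‖ + ‖X (v t) - v' t‖ := norm_add_le _ _
      _ ≤ K * ‖radial ε (u t - v t)‖ + η := add_le_add h1 (hvη t ht)
      _ ≤ _ := by gcongr; exact norm_radial_le_norm hε _
  have hneg : ∀ t ∈ Icc (-1 : ℝ) 1, -t ∈ Icc (-1 : ℝ) 1 := fun t ht =>
    ⟨by linarith [ht.2], by linarith [ht.1]⟩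
  have hnear : ∀ t ∈ Icc (-1 : ℝ) 1, ‖u t - v t‖ ≤ ε := by
    intro t ht
    rcases le_total 0 t with h0 | h0
    · exact (norm_le_mul_exp_of_norm_deriv_le hK hη hw (by simp [hu0]) hb t ⟨h0, ht.2⟩).trans hηε
    · have := norm_le_mul_exp_of_norm_deriv_le (w := fun t => u (-t) - v (-t))
        (w' := fun t => -(f (-t) (u (-t)) - v' (-t))) hK hη
        (fun t ht => by
          have := (hw (-t) (hneg t ht)).scomp t (hasDerivAt_neg t).hasDerivWithinAt hneg
          simpa [Function.comp_def] using this)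
        (by simp [hu0]) (fun t ht => by rw [norm_neg]; exact hb _ (hneg t ht)) (-t)
        ⟨by linarith, by linarith [ht.1]⟩
      simp only [neg_neg] at this
      exact this.trans hηε
  refine ⟨u, hu0, fun t ht => ⟨?_, hnear t ht⟩⟩
  have := hu t ht
  simp only [hf] at this
  rwa [radial_eq_self hε (hnear t ht), add_sub_cancel] at this

end ODE

/-- The (real) kernel of the truncated Birkhoff vector field. -/
def birkhoffKernel (α σ : ℝ) (N : ℕ∞) (n : ℤ) (p : ℤ × ℤ) : ℝ :=
  if inBall N n ∧ inBall N p.1 ∧ inBall N p.2 ∧ inBall N (p.1 + p.2 - n) ∧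
      res α p.1 p.2 (p.1 + p.2 - n) ≠ 0 then
    -σ / res α p.1 p.2 (p.1 + p.2 - n)
  else 0

lemma XB_eq_tsum (α σ : ℝ) (N : ℕ∞) (u : ℤ → ℂ) (n : ℤ) :
    XB α σ N u n = ∑' p : ℤ × ℤ, (birkhoffKernel α σ N n p : ℂ) *
      (u p.1 * u p.2 * conj (u (p.1 + p.2 - n))) := by
  unfold XB birkhoffKernel
  by_cases hn : inBall N n
  · simp only [hn, if_true, true_and]
    refine tsum_congr fun p => ?_
    split_ifs <;> simp
  · simp [hn]

lemma inBall_top (j : ℤ) : inBall ⊤ j := le_top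

lemma birkhoffKernel_top_or_zero (α σ : ℝ) (N : ℕ∞) (n : ℤ) (p : ℤ × ℤ) :
    birkhoffKernel α σ N n p = birkhoffKernel α σ ⊤ n p ∨ birkhoffKernel α σ N n p = 0 := by
  unfold birkhoffKernel
  by_cases h : inBall N n ∧ inBall N p.1 ∧ inBall N p.2 ∧ inBall N (p.1 + p.2 - n) ∧
      res α p.1 p.2 (p.1 + p.2 - n) ≠ 0
  · left
    rw [if_pos h, if_pos ⟨inBall_top _, inBall_top _, inBall_top _, inBall_top _, h.2.2.2.2⟩]
  · right; simp only [if_neg h]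

lemma birkhoffKernel_eq_top (α σ : ℝ) {N : ℕ∞} {n : ℤ} {p : ℤ × ℤ} (h₀ : inBall N n)
    (h₁ : inBall N p.1) (h₂ : inBall N p.2) (h₃ : inBall N (p.1 + p.2 - n)) :
    birkhoffKernel α σ N n p = birkhoffKernel α σ ⊤ n p := by
  simp [birkhoffKernel, h₀, h₁, h₂, h₃, inBall_top]

lemma abs_birkhoffKernel_le_top (α σ : ℝ) (N : ℕ∞) (n : ℤ) (p : ℤ × ℤ) :
    |birkhoffKernel α σ N n p| ≤ |birkhoffKernel α σ ⊤ n p| := by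
  rcases birkhoffKernel_top_or_zero α σ N n p with h | h <;> simp [h]

lemma abs_birkhoffKernel_sub_le_top (α σ : ℝ) (N : ℕ∞) (n : ℤ) (p : ℤ × ℤ) :
    |birkhoffKernel α σ ⊤ n p - birkhoffKernel α σ N n p| ≤ |birkhoffKernel α σ ⊤ n p| := by
  rcases birkhoffKernel_top_or_zero α σ N n p with h | h <;> simp [h]

lemma abs_birkhoffKernel_le {α σ : ℝ} (hα₁ : 3 / 4 < α) (hα₂ : α ≤ 1) (hσ : |σ| = 1)
    {n : ℤ} {p : ℤ × ℤ} {P : ℝ} (hP : 0 < P)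
    (hM : n ≠ p.1 → n ≠ p.2 → |(p.1 : ℝ)| + |(p.2 : ℝ)| + |((p.1 + p.2 - n : ℤ) : ℝ)| ≤
      4 * (|((n - p.1 : ℤ) : ℝ)| * |((n - p.2 : ℤ) : ℝ)|) * P) :
    |birkhoffKernel α σ ⊤ n p| ≤
      3 * (|((n - p.1 : ℤ) : ℝ)| ^ (1 - 2 * α) * |((n - p.2 : ℤ) : ℝ)| ^ (1 - 2 * α)) *
        P ^ (2 - 2 * α) := by
  unfold birkhoffKernel
  split_ifs with h
  swap
  · rw [abs_zero]; positivity
  have hres := h.2.2.2.2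
  have h1 : n ≠ p.1 := by
    rintro rfl; apply hres; simp [res]
  have h2 : n ≠ p.2 := by
    rintro rfl; apply hres; simp [res]
  have hM := hM h1 h2
  set A : ℝ := |((n - p.1 : ℤ) : ℝ)| with hA
  set B : ℝ := |((n - p.2 : ℤ) : ℝ)| with hB
  have hA0 : 0 < A := abs_pos.2 (Int.cast_ne_zero.2 (sub_ne_zero.2 h1))
  have hB0 : 0 < B := abs_pos.2 (Int.cast_ne_zero.2 (sub_ne_zero.2 h2))
  set M : ℝ := |(p.1 : ℝ)| + |(p.2 : ℝ)| + |((p.1 + p.2 - n : ℤ) : ℝ)| with hMdef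
  have hBeq : |(p.1 : ℝ) - ((p.1 + p.2 - n : ℤ) : ℝ)| = B := by
    rw [hB]; congr 1; push_cast; ring
  have hAeq : |(p.2 : ℝ) - ((p.1 + p.2 - n : ℤ) : ℝ)| = A := by
    rw [hA]; congr 1; push_cast; ring
  have a1 := abs_nonneg (p.1 : ℝ)
  have a2 := abs_nonneg (p.2 : ℝ)
  have a3 := abs_nonneg ((p.1 + p.2 - n : ℤ) : ℝ)
  have hM0 : 0 < M := by
    have := abs_sub (p.1 : ℝ) ((p.1 + p.2 - n : ℤ) : ℝ)
    rw [hBeq] at this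
    linarith
  have hn : |((p.1 + p.2 - (p.1 + p.2 - n) : ℤ) : ℝ)| ≤ M := by
    have h4 : ((p.1 + p.2 - (p.1 + p.2 - n) : ℤ) : ℝ) =
        (p.1 + p.2 : ℝ) - ((p.1 + p.2 - n : ℤ) : ℝ) := by push_cast; ring
    rw [h4]
    exact (abs_sub _ _).trans (by have := abs_add_le (p.1 : ℝ) p.2; linarith)
  have hlow := le_abs_rpow_add_sub (M := M) (by linarith) hα₂
    (x₁ := (p.1 : ℝ)) (x₂ := (p.2 : ℝ)) (x₃ := ((p.1 + p.2 - n : ℤ) : ℝ))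
    (x₄ := ((p.1 + p.2 - (p.1 + p.2 - n) : ℤ) : ℝ))
    (by linarith) (by linarith) (by linarith) hn (by push_cast; ring)
  rw [hBeq, hAeq] at hlow
  change _ ≤ |res α p.1 p.2 (p.1 + p.2 - n)| at hlow
  have hpow : (4 * (A * B) * P) ^ (2 * α - 2) ≤ M ^ (2 * α - 2) :=
    Real.rpow_le_rpow_of_nonpos hM0 hM (by linarith)
  rw [Real.mul_rpow (by positivity) hP.le, Real.mul_rpow (by positivity) (by positivity)] at hpow
  have h4 : (1 / 2 : ℝ) ≤ 4 ^ (2 * α - 2) := by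
    calc (1 / 2 : ℝ) = 4 ^ (-(1 / 2) : ℝ) := by
          rw [Real.rpow_neg (by norm_num), ← Real.sqrt_eq_rpow,
            show (4 : ℝ) = 2 ^ 2 by norm_num, Real.sqrt_sq (by norm_num)]; norm_num
      _ ≤ _ := Real.rpow_le_rpow_of_exponent_le (by norm_num) (by linarith)
  have hABpow : A ^ (1 - 2 * α) * B ^ (1 - 2 * α) = ((A * B) ^ (2 * α - 2) * (A * B))⁻¹ := by
    rw [← Real.rpow_add_one (by positivity), ← Real.rpow_neg (by positivity),
      ← Real.mul_rpow hA0.le hB0.le]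
    congr 1; ring
  have hPpow : P ^ (2 - 2 * α) = (P ^ (2 * α - 2))⁻¹ := by
    rw [← Real.rpow_neg hP.le]; congr 1; ring
  set Q : ℝ := (A * B) ^ (2 * α - 2) * (A * B) with hQ
  set T : ℝ := P ^ (2 * α - 2) with hT
  have hQ0 : 0 < Q := by positivity
  have hT0 : 0 < T := by positivity
  have hres' : Q * T / 3 ≤ |res α p.1 p.2 (p.1 + p.2 - n)| := by
    refine le_trans ?_ hlow
    have hc : (3 / 4 : ℝ) ≤ 2 * α * (2 * α - 1) := by nlinarith
    calc Q * T / 3 ≤ 3 / 4 * (1 / 2 * (A * B) ^ (2 * α - 2) * T) * (A * B) := by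
          have := mul_pos hQ0 hT0
          rw [show 3 / 4 * (1 / 2 * (A * B) ^ (2 * α - 2) * T) * (A * B) = 3 / 8 * (Q * T) by
            rw [hQ]; ring]
          linarith
      _ ≤ 3 / 4 * M ^ (2 * α - 2) * (A * B) := by
          gcongr
          refine le_trans ?_ hpow
          gcongr
      _ ≤ _ := by
          rw [mul_comm B A]
          gcongr
  rw [abs_div, abs_neg, hσ, hABpow, hPpow, div_le_iff₀ (abs_pos.2 hres)]
  calc (1 : ℝ) = 3 * Q⁻¹ * T⁻¹ * (Q * T / 3) := by field_simp
    _ ≤ _ := by gcongr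

/-- Kernel bound used for weighted estimates. -/
def kernelProfile (α : ℝ) (a : ℤ) : ℝ≥0∞ := ENNReal.ofReal (|(a : ℝ)| ^ (1 - 2 * α))

lemma tsum_kernelProfile_ne_top {α : ℝ} (hα : 3 / 4 < α) :
    ∑' a, kernelProfile α a ^ 2 ≠ ⊤ := by
  have h : ∀ a : ℤ, kernelProfile α a ^ 2 = ENNReal.ofReal (|(a : ℝ)| ^ (-(4 * α - 2))) := by
    intro a
    rw [kernelProfile, ← ENNReal.ofReal_pow (by positivity), ← Real.rpow_natCast,
      ← Real.rpow_mul (abs_nonneg _)]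
    congr 2; push_cast; ring
  simp_rw [h]
  exact (Real.summable_abs_int_rpow (by linarith)).tsum_ofReal_ne_top

/-- The kernel `k`, conjugated by the input weight `W` and the output weight `w`. -/
def weightedKernel (w W : ℤ → ℝ) (k : ℤ → ℤ × ℤ → ℝ) (n : ℤ) (p : ℤ × ℤ) : ℂ :=
  ((w n * k n p / (W p.1 * W p.2 * W (p.1 + p.2 - n)) : ℝ) : ℂ)

lemma triSum_weightedKernel {w W : ℤ → ℝ} (hW : ∀ j, 0 < W j) (k : ℤ → ℤ × ℤ → ℝ)
    {x u : ℤ → ℂ} (hx : ∀ j, x j = W j * u j) (n : ℤ) :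
    triSum (weightedKernel w W k) x x x n =
      w n * ∑' p : ℤ × ℤ, (k n p : ℂ) * (u p.1 * u p.2 * conj (u (p.1 + p.2 - n))) := by
  rw [triSum, ← tsum_mul_left]
  refine tsum_congr fun p => ?_
  have h : ∀ j, (W j : ℂ) ≠ 0 := fun j => Complex.ofReal_ne_zero.2 (hW j).ne'
  have h1 := h p.1
  have h2 := h p.2
  have h3 := h (p.1 + p.2 - n)
  simp only [hx, weightedKernel, map_mul, Complex.conj_ofReal]
  push_cast
  field_simp

lemma summable_of_summable_weightedKernel {w W : ℤ → ℝ} (hw : ∀ j, 0 < w j) (hW : ∀ j, 0 < W j)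
    {k : ℤ → ℤ × ℤ → ℝ} {x u : ℤ → ℂ} (hx : ∀ j, x j = W j * u j) {n : ℤ}
    (hs : Summable fun p : ℤ × ℤ =>
      weightedKernel w W k n p * (x p.1 * x p.2 * conj (x (p.1 + p.2 - n)))) :
    Summable fun p : ℤ × ℤ => (k n p : ℂ) * (u p.1 * u p.2 * conj (u (p.1 + p.2 - n))) := by
  refine (hs.mul_left ((w n : ℂ)⁻¹)).congr fun p => ?_
  have h : ∀ j, (W j : ℂ) ≠ 0 := fun j => Complex.ofReal_ne_zero.2 (hW j).ne'
  have h0 : (w n : ℂ) ≠ 0 := Complex.ofReal_ne_zero.2 (hw n).ne'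
  have h1 := h p.1
  have h2 := h p.2
  have h3 := h (p.1 + p.2 - n)
  simp only [hx, weightedKernel, map_mul, Complex.conj_ofReal]
  push_cast
  field_simp

lemma le_prod_four {a b c d : ℝ} (ha : 1 ≤ a) (hb : 1 ≤ b) (hc : 1 ≤ c) (hd : 1 ≤ d) :
    a ≤ a * b * (c * d) ∧ b ≤ a * b * (c * d) ∧ c ≤ a * b * (c * d) ∧ d ≤ a * b * (c * d) := by
  have hab := one_le_mul_of_one_le_of_one_le ha hb
  have hcd := one_le_mul_of_one_le_of_one_le hc hd
  have h1 : a * b ≤ a * b * (c * d) := le_mul_of_one_le_right (by linarith) hcd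
  have h2 : c * d ≤ a * b * (c * d) := le_mul_of_one_le_left (by linarith) hab
  have h3 : a ≤ a * b := le_mul_of_one_le_right (by linarith) hb
  have h4 : b ≤ a * b := le_mul_of_one_le_left (by linarith) ha
  have h5 : c ≤ c * d := le_mul_of_one_le_right (by linarith) hd
  have h6 : d ≤ c * d := le_mul_of_one_le_left (by linarith) hc
  exact ⟨h3.trans h1, h4.trans h1, h5.trans h2, h6.trans h2⟩

lemma kernelBound_weightedKernel {α σ : ℝ} (hα₁ : 3 / 4 < α) (hα₂ : α ≤ 1) (hσ : |σ| = 1)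
    {w W : ℤ → ℝ} {K : ℝ} (hK : 0 ≤ K) (hw : ∀ j, 0 < w j)
    (hW : ∀ j : ℤ, max 1 |(j : ℝ)| ^ (2 - 2 * α) ≤ W j) {k : ℤ → ℤ × ℤ → ℝ}
    (hk : ∀ n p, |k n p| ≤ |birkhoffKernel α σ ⊤ n p|)
    (hwW : ∀ n p, k n p ≠ 0 →
      w n ≤ K * W p.1 ∨ w n ≤ K * W p.2 ∨ w n ≤ K * W (p.1 + p.2 - n)) :
    KernelBound (weightedKernel w W k) (ENNReal.ofReal (3 * K)) (kernelProfile α) := by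
  intro n p
  have hW0 : ∀ j, 0 < W j := fun j => lt_of_lt_of_le (by positivity) (hW j)
  set g : ℝ := |((n - p.1 : ℤ) : ℝ)| ^ (1 - 2 * α) * |((n - p.2 : ℤ) : ℝ)| ^ (1 - 2 * α) with hg
  have hg0 : 0 ≤ g := by positivity
  rw [kernelProfile, kernelProfile, ← ENNReal.ofReal_mul (by positivity),
    ← ENNReal.ofReal_mul (by positivity), ← hg, ← ofReal_norm]
  refine ENNReal.ofReal_le_ofReal ?_
  have h1 := hW0 p.1
  have h2 := hW0 p.2
  have h3 := hW0 (p.1 + p.2 - n)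
  rw [weightedKernel, Complex.norm_real, Real.norm_eq_abs, abs_div, abs_mul,
    abs_of_pos (hw n), abs_of_pos (mul_pos (mul_pos h1 h2) h3), div_le_iff₀ (by positivity)]
  by_cases hk0 : k n p = 0
  · rw [hk0, abs_zero, mul_zero]; positivity
  have key : ∀ i j : ℤ, (n ≠ p.1 → n ≠ p.2 →
      |(p.1 : ℝ)| + |(p.2 : ℝ)| + |((p.1 + p.2 - n : ℤ) : ℝ)| ≤
      4 * (|((n - p.1 : ℤ) : ℝ)| * |((n - p.2 : ℤ) : ℝ)|) *
        (max 1 |(i : ℝ)| * max 1 |(j : ℝ)|)) → |k n p| ≤ 3 * g * (W i * W j) := by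
    intro i j h
    refine (hk n p).trans ((abs_birkhoffKernel_le hα₁ hα₂ hσ (by positivity) h).trans ?_)
    rw [← hg, Real.mul_rpow (by positivity) (by positivity)]
    have := (hW0 i).le
    gcongr
    · exact hW i
    · exact hW j
  have hone : ∀ a b : ℤ, a ≠ b → (1 : ℝ) ≤ |((a - b : ℤ) : ℝ)| := by
    intro a b hab
    rw [← Int.cast_abs]
    exact_mod_cast Int.one_le_abs (sub_ne_zero.2 hab)
  have e1 : (p.1 : ℝ) = ((p.1 + p.2 - n : ℤ) : ℝ) + ((n - p.2 : ℤ) : ℝ) := by push_cast; ring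
  have e2 : (p.2 : ℝ) = ((p.1 + p.2 - n : ℤ) : ℝ) + ((n - p.1 : ℤ) : ℝ) := by push_cast; ring
  have t1 : |(p.1 : ℝ)| ≤ |((p.1 + p.2 - n : ℤ) : ℝ)| + |((n - p.2 : ℤ) : ℝ)| := by
    conv_lhs => rw [e1]
    exact abs_add_le _ _
  have t2 : |(p.2 : ℝ)| ≤ |((p.1 + p.2 - n : ℤ) : ℝ)| + |((n - p.1 : ℤ) : ℝ)| := by
    conv_lhs => rw [e2]
    exact abs_add_le _ _
  have t3 : |((p.1 + p.2 - n : ℤ) : ℝ)| ≤ |(p.1 : ℝ)| + |((n - p.2 : ℤ) : ℝ)| := by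
    have e3 : ((p.1 + p.2 - n : ℤ) : ℝ) = (p.1 : ℝ) - ((n - p.2 : ℤ) : ℝ) := by push_cast; ring
    conv_lhs => rw [e3]
    exact abs_sub _ _
  have m1 := le_max_right 1 |(p.1 : ℝ)|
  have m2 := le_max_right 1 |(p.2 : ℝ)|
  have m3 := le_max_right 1 |((p.1 + p.2 - n : ℤ) : ℝ)|
  have l1 := le_max_left 1 |(p.1 : ℝ)|
  have l2 := le_max_left 1 |(p.2 : ℝ)|
  have l3 := le_max_left 1 |((p.1 + p.2 - n : ℤ) : ℝ)|
  rcases hwW n p hk0 with h | h | h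
  · have := key p.2 (p.1 + p.2 - n) fun ha hb => by
      obtain ⟨q1, q2, q3, q4⟩ := le_prod_four (hone _ _ ha) (hone _ _ hb) l2 l3
      linarith
    calc w n * |k n p| ≤ (K * W p.1) * (3 * g * (W p.2 * W (p.1 + p.2 - n))) := by gcongr
      _ = _ := by ring
  · have := key p.1 (p.1 + p.2 - n) fun ha hb => by
      obtain ⟨q1, q2, q3, q4⟩ := le_prod_four (hone _ _ ha) (hone _ _ hb) l1 l3
      linarith
    calc w n * |k n p| ≤ (K * W p.2) * (3 * g * (W p.1 * W (p.1 + p.2 - n))) := by gcongr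
      _ = _ := by ring
  · have := key p.1 p.2 fun ha hb => by
      obtain ⟨q1, q2, q3, q4⟩ := le_prod_four (hone _ _ ha) (hone _ _ hb) l1 l2
      linarith
    calc w n * |k n p| ≤ (K * W (p.1 + p.2 - n)) * (3 * g * (W p.1 * W p.2)) := by gcongr
      _ = _ := by ring

/-- The square of the weight defining the `H^t` norm. -/
def japSq (t : ℝ) (n : ℤ) : ℝ := 1 + |(n : ℝ)| ^ (2 * t)

lemma one_le_japSq (t : ℝ) (n : ℤ) : 1 ≤ japSq t n :=
  le_add_of_nonneg_right (Real.rpow_nonneg (abs_nonneg _) _)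

lemma japSq_pos (t : ℝ) (n : ℤ) : 0 < japSq t n := zero_lt_one.trans_le (one_le_japSq t n)

lemma sqrt_japSq_pos (t : ℝ) (n : ℤ) : 0 < √(japSq t n) := Real.sqrt_pos.2 (japSq_pos t n)

lemma max_one_rpow_le_sqrt_japSq {a t : ℝ} (hat : a ≤ t) (n : ℤ) :
    max 1 |(n : ℝ)| ^ a ≤ √(japSq t n) := by
  refine Real.le_sqrt_of_sq_le ?_
  rw [← Real.rpow_natCast, ← Real.rpow_mul (by positivity), japSq]
  rcases le_total |(n : ℝ)| 1 with h | h
  · rw [max_eq_left h, Real.one_rpow]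
    exact one_le_japSq t n
  · rw [max_eq_right h]
    have := Real.rpow_le_rpow_of_exponent_le h (show a * (2 : ℕ) ≤ 2 * t by push_cast; linarith)
    linarith

lemma japSq_le_of_abs_le {t s : ℝ} (ht : 0 ≤ t) (hts : t ≤ s) {n j : ℤ} (h : |n| ≤ 3 * |j|) :
    japSq t n ≤ 9 ^ s * japSq t j := by
  have h' : |(n : ℝ)| ≤ 3 * |(j : ℝ)| := by exact_mod_cast h
  have h1 : |(n : ℝ)| ^ (2 * t) ≤ 9 ^ t * |(j : ℝ)| ^ (2 * t) := by
    refine (Real.rpow_le_rpow (abs_nonneg _) h' (by linarith)).trans_eq ?_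
    rw [Real.mul_rpow (by norm_num) (abs_nonneg _), Real.rpow_mul (by norm_num)]
    norm_num
  have h2 : (1 : ℝ) ≤ 9 ^ t := Real.one_le_rpow (by norm_num) ht
  have h3 : (9 : ℝ) ^ t ≤ 9 ^ s := Real.rpow_le_rpow_of_exponent_le (by norm_num) hts
  calc japSq t n ≤ 9 ^ t * japSq t j := by unfold japSq; linarith
    _ ≤ _ := by have := (japSq_pos t j).le; gcongr

lemma japSq_le_two_mul {t s : ℝ} (ht : 0 ≤ t) (hts : t ≤ s) (n : ℤ) :
    japSq t n ≤ 2 * japSq s n := by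
  have h0 := Real.rpow_nonneg (abs_nonneg (n : ℝ)) (2 * s)
  have h : |(n : ℝ)| ^ (2 * t) ≤ 1 + |(n : ℝ)| ^ (2 * s) := by
    rcases le_total |(n : ℝ)| 1 with h | h
    · have := Real.rpow_le_one (abs_nonneg _) h (show 0 ≤ 2 * t by linarith)
      linarith
    · have := Real.rpow_le_rpow_of_exponent_le h (show 2 * t ≤ 2 * s by linarith)
      linarith
  unfold japSq
  linarith

lemma exists_forall_japSq_le {t s δ : ℝ} (ht : 0 ≤ t) (hts : t < s) (hδ : 0 < δ) :
    ∃ M : ℕ, ∀ j : ℤ, M ≤ j.natAbs → japSq t j ≤ δ ^ 2 * japSq s j := by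
  have hlim := (tendsto_rpow_atTop (show 0 < 2 * s - 2 * t by linarith)).comp
    tendsto_natCast_atTop_atTop
  obtain ⟨M, hM⟩ := eventually_atTop.1
    ((hlim.eventually_ge_atTop (2 / δ ^ 2)).and (eventually_ge_atTop 1))
  refine ⟨M, fun j hj => ?_⟩
  obtain ⟨h1, h2⟩ := hM _ hj
  have hx : ((j.natAbs : ℕ) : ℝ) = |(j : ℝ)| := by rw [Nat.cast_natAbs, Int.cast_abs]
  simp only [Function.comp_apply, hx] at h1
  have hx1 : 1 ≤ |(j : ℝ)| := by rw [← hx]; exact_mod_cast h2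
  rw [Real.rpow_sub (by linarith), div_le_div_iff₀ (by positivity) (by positivity)] at h1
  have h3 := Real.one_le_rpow hx1 (show 0 ≤ 2 * t by linarith)
  unfold japSq
  nlinarith [sq_nonneg δ]

lemma hsE_sq (s : ℝ) (f : ℤ → ℂ) :
    hsE s f ^ 2 = ∑' n, ‖(√(japSq s n) : ℂ) * f n‖ₑ ^ 2 := by
  rw [hsE, ← ENNReal.rpow_two, ← ENNReal.rpow_mul]
  norm_num
  refine tsum_congr fun n => ?_
  rw [mul_pow]
  congr 1
  rw [← ofReal_norm, Complex.norm_real, Real.norm_eq_abs, abs_of_nonneg (Real.sqrt_nonneg _),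
    ← ENNReal.ofReal_pow (Real.sqrt_nonneg _), Real.sq_sqrt (japSq_pos s n).le, japSq]

lemma enorm_ofReal_mul_le {a b c : ℝ} (hb : 0 ≤ b) (hc : 0 ≤ c) (h : |a| ≤ c * b)
    (z : ℂ) : ‖(a : ℂ) * z‖ₑ ≤ ENNReal.ofReal c * ‖(b : ℂ) * z‖ₑ := by
  rw [enorm_mul, enorm_mul, ← mul_assoc]
  gcongr
  rw [← ofReal_norm, ← ofReal_norm, Complex.norm_real, Complex.norm_real, Real.norm_eq_abs,
    Real.norm_eq_abs, abs_of_nonneg hb, ← ENNReal.ofReal_mul hc]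
  exact ENNReal.ofReal_le_ofReal h

lemma hsE_le_mul_enorm {s c : ℝ} (hc : 0 ≤ c) {w : ℤ → ℝ} (hw : ∀ n, 0 ≤ w n)
    (h : ∀ n, √(japSq s n) ≤ c * w n) {f : ℤ → ℂ} {x : Ell2} (hx : ∀ n, x n = w n * f n) :
    hsE s f ≤ ENNReal.ofReal c * ‖x‖ₑ := by
  rw [← (ENNReal.pow_right_strictMono two_ne_zero).le_iff_le, mul_pow, enorm_sq_eq_tsum, hsE_sq,
    ← ENNReal.tsum_mul_left]
  refine ENNReal.tsum_le_tsum fun n => ?_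
  rw [hx, ← mul_pow]
  gcongr
  exact enorm_ofReal_mul_le (hw n) hc (by rw [abs_of_pos (sqrt_japSq_pos s n)]; exact h n) _

lemma tsum_enorm_sq_le_hsE {s c : ℝ} (hc : 0 ≤ c) {w : ℤ → ℝ} (hw : ∀ n, 0 ≤ w n)
    (h : ∀ n, w n ≤ c * √(japSq s n)) (f : ℤ → ℂ) :
    ∑' n, ‖(w n : ℂ) * f n‖ₑ ^ 2 ≤ (ENNReal.ofReal c * hsE s f) ^ 2 := by
  rw [mul_pow, hsE_sq, ← ENNReal.tsum_mul_left]
  refine ENNReal.tsum_le_tsum fun n => ?_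
  rw [← mul_pow]
  gcongr
  exact enorm_ofReal_mul_le (Real.sqrt_nonneg _) hc (by rw [abs_of_nonneg (hw n)]; exact h n) _

lemma enorm_le_mul_hsE {s c : ℝ} (hc : 0 ≤ c) {w : ℤ → ℝ} (hw : ∀ n, 0 ≤ w n)
    (h : ∀ n, w n ≤ c * √(japSq s n)) {f : ℤ → ℂ} {x : Ell2} (hx : ∀ n, x n = w n * f n) :
    ‖x‖ₑ ≤ ENNReal.ofReal c * hsE s f := by
  rw [← (ENNReal.pow_right_strictMono two_ne_zero).le_iff_le, enorm_sq_eq_tsum]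
  simp_rw [hx]
  exact tsum_enorm_sq_le_hsE hc hw h f

lemma memℓp_weight_mul {s c : ℝ} (hc : 0 ≤ c) {w : ℤ → ℝ} (hw : ∀ n, 0 ≤ w n)
    (h : ∀ n, w n ≤ c * √(japSq s n)) {f : ℤ → ℂ} (hf : hsE s f ≠ ⊤) :
    Memℓp (fun n => (w n : ℂ) * f n) 2 :=
  memℓp_two_iff.2 ((tsum_enorm_sq_le_hsE hc hw h f).trans_lt
    (ENNReal.pow_lt_top (ENNReal.mul_lt_top ENNReal.ofReal_lt_top hf.lt_top))).ne

/-- The square-summable sequence underlying `f`, with junk value `0`. -/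
def toEll2 (f : ℤ → ℂ) : Ell2 := if h : Memℓp f 2 then ⟨f, h⟩ else 0

lemma toEll2_apply {f : ℤ → ℂ} (h : Memℓp f 2) (n : ℤ) : toEll2 f n = f n := by
  rw [toEll2, dif_pos h]

lemma tendsto_sub_nhdsWithin (A : Set ℝ) (t : ℝ) :
    Tendsto (fun y => y - t) (nhdsWithin t (A \ {t})) (nhdsWithin 0 {h | t + h ∈ A ∧ h ≠ 0}) := by
  refine tendsto_nhdsWithin_iff.2 ⟨?_, ?_⟩
  · have : Tendsto (fun y => y - t) (nhds t) (nhds (t - t)) := by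
      exact (continuous_id.sub continuous_const).tendsto t
    rw [sub_self] at this
    exact this.mono_left nhdsWithin_le_nhds
  · filter_upwards [self_mem_nhdsWithin] with y hy
    exact ⟨by simpa using hy.1, sub_ne_zero.2 hy.2⟩

lemma tendsto_add_nhdsWithin (A : Set ℝ) (t : ℝ) :
    Tendsto (fun h => t + h) (nhdsWithin 0 {h | t + h ∈ A ∧ h ≠ 0}) (nhdsWithin t (A \ {t})) := by
  refine tendsto_nhdsWithin_iff.2 ⟨?_, ?_⟩
  · have : Tendsto (fun h => t + h) (nhds 0) (nhds (t + 0)) := by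
      exact (continuous_const.add continuous_id).tendsto 0
    rw [add_zero] at this
    exact this.mono_left nhdsWithin_le_nhds
  · filter_upwards [self_mem_nhdsWithin] with y hy
    exact ⟨hy.1, by simpa using hy.2⟩

lemma HasHsDerivWithinAt.hasDerivWithinAt {s c : ℝ} (hc : 0 ≤ c) {w : ℤ → ℝ}
    (hw : ∀ n, 0 ≤ w n) (h : ∀ n, w n ≤ c * √(japSq s n)) {u : ℝ → ℤ → ℂ} {d : ℤ → ℂ} {A : Set ℝ}
    {t : ℝ} (hu : HasHsDerivWithinAt s u d A t) {v : ℝ → Ell2} {v' : Ell2}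
    (ht : t ∈ A) (hv : ∀ y ∈ A, ∀ n, v y n = w n * u y n) (hv' : ∀ n, v' n = w n * d n) :
    HasDerivWithinAt v v' A t := by
  rw [hasDerivWithinAt_iff_tendsto_slope, tendsto_iff_edist_tendsto_0]
  have hlim := ENNReal.Tendsto.const_mul (hu.comp (tendsto_sub_nhdsWithin A t))
    (Or.inr (ENNReal.ofReal_ne_top (r := c)))
  rw [mul_zero] at hlim
  refine tendsto_of_tendsto_of_tendsto_of_le_of_le' tendsto_const_nhds hlim
    (Eventually.of_forall fun _ => zero_le) ?_
  filter_upwards [self_mem_nhdsWithin] with y hy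
  rw [edist_eq_enorm_sub]
  refine enorm_le_mul_hsE hc hw h fun n => ?_
  have h1 : (slope v t y - v') n = ((y - t)⁻¹ : ℝ) • (v y n - v t n) - v' n := by
    rw [slope_def_module]; rfl
  rw [h1, hv y hy.1, hv t ht, hv', add_sub_cancel, Complex.real_smul]
  push_cast
  ring

lemma HasDerivWithinAt.hasHsDerivWithinAt {s c : ℝ} (hc : 0 ≤ c) {w : ℤ → ℝ}
    (hw : ∀ n, 0 ≤ w n) (h : ∀ n, √(japSq s n) ≤ c * w n) {u : ℝ → ℤ → ℂ} {d : ℤ → ℂ} {A : Set ℝ}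
    {t : ℝ} {v : ℝ → Ell2} {v' : Ell2} (hv : HasDerivWithinAt v v' A t)
    (hu : ∀ y n, v y n = w n * u y n) (hd : ∀ n, v' n = w n * d n) :
    HasHsDerivWithinAt s u d A t := by
  rw [hasDerivWithinAt_iff_tendsto_slope, tendsto_iff_edist_tendsto_0] at hv
  have hlim := ENNReal.Tendsto.const_mul (hv.comp (tendsto_add_nhdsWithin A t))
    (Or.inr (ENNReal.ofReal_ne_top (r := c)))
  rw [mul_zero] at hlim
  refine tendsto_of_tendsto_of_tendsto_of_le_of_le tendsto_const_nhds hlim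
    (fun _ => zero_le) fun y => ?_
  simp only [Function.comp_apply, edist_eq_enorm_sub]
  refine hsE_le_mul_enorm hc hw h fun n => ?_
  have h1 : (slope v t (t + y) - v') n = ((t + y - t)⁻¹ : ℝ) • (v (t + y) n - v t n) - v' n := by
    rw [slope_def_module]; rfl
  rw [h1, hu, hu, hd, add_sub_cancel_left, Complex.real_smul]
  push_cast
  ring

/-- Weight interpolating between the `H^{s'}` norm and `δ` times the `H^s` norm. -/
def mixedWeight (s' s δ : ℝ) (n : ℤ) : ℝ := √(japSq s' n + δ ^ 2 * japSq s n)

section MixedWeight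

variable {s' s δ : ℝ}

lemma mixedWeight_pos (s' s δ : ℝ) (n : ℤ) : 0 < mixedWeight s' s δ n :=
  Real.sqrt_pos.2 (add_pos_of_pos_of_nonneg (japSq_pos s' n)
    (mul_nonneg (sq_nonneg δ) (japSq_pos s n).le))

lemma sqrt_japSq_le_mixedWeight (n : ℤ) : √(japSq s' n) ≤ mixedWeight s' s δ n :=
  Real.sqrt_le_sqrt (le_add_of_nonneg_right (mul_nonneg (sq_nonneg δ) (japSq_pos s n).le))

lemma sqrt_japSq_le_inv_mul_mixedWeight (hδ : 0 < δ) (n : ℤ) :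
    √(japSq s n) ≤ δ⁻¹ * mixedWeight s' s δ n := by
  rw [← div_eq_inv_mul, le_div_iff₀' hδ]
  nth_rewrite 1 [← Real.sqrt_sq hδ.le]
  rw [← Real.sqrt_mul (sq_nonneg δ)]
  exact Real.sqrt_le_sqrt (le_add_of_nonneg_left (japSq_pos s' n).le)

lemma mixedWeight_le_two_mul (hs' : 0 ≤ s') (hss : s' ≤ s) (hδ : 0 < δ) (hδ1 : δ ≤ 1) (n : ℤ) :
    mixedWeight s' s δ n ≤ 2 * √(japSq s n) := by
  refine Real.sqrt_le_iff.2 ⟨by positivity, ?_⟩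
  rw [mul_pow, Real.sq_sqrt (japSq_pos s n).le]
  have h1 := japSq_le_two_mul hs' hss n
  have h2 : δ ^ 2 * japSq s n ≤ japSq s n :=
    mul_le_of_le_one_left (japSq_pos s n).le (pow_le_one₀ hδ.le hδ1)
  linarith [japSq_pos s n]

lemma mixedWeight_le_mul_of_japSq_le (hδ : 0 < δ) {n : ℤ}
    (h : japSq s' n ≤ δ ^ 2 * japSq s n) : mixedWeight s' s δ n ≤ 2 * δ * √(japSq s n) := by
  refine Real.sqrt_le_iff.2 ⟨by positivity, ?_⟩
  rw [mul_pow, Real.sq_sqrt (japSq_pos s n).le]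
  nlinarith [japSq_pos s n, mul_pos (pow_pos hδ 2) (japSq_pos s n)]

lemma mixedWeight_le_of_abs_le (hs' : 0 ≤ s') (hss : s' ≤ s) {n j : ℤ} (h : |n| ≤ 3 * |j|) :
    mixedWeight s' s δ n ≤ √(9 ^ s) * mixedWeight s' s δ j := by
  rw [mixedWeight, mixedWeight, ← Real.sqrt_mul (by positivity)]
  refine Real.sqrt_le_sqrt ?_
  have h1 := japSq_le_of_abs_le hs' hss h
  have h2 := mul_le_mul_of_nonneg_left (japSq_le_of_abs_le (hs'.trans hss) le_rfl h) (sq_nonneg δ)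
  linarith

end MixedWeight

lemma natAbs_le_three_mul (n : ℤ) (p : ℤ × ℤ) :
    ∃ j, (j = p.1 ∨ j = p.2 ∨ j = p.1 + p.2 - n) ∧ n.natAbs ≤ 3 * j.natAbs ∧
      p.1.natAbs ≤ j.natAbs ∧ p.2.natAbs ≤ j.natAbs ∧ (p.1 + p.2 - n).natAbs ≤ j.natAbs := by
  rcases le_total p.1.natAbs p.2.natAbs with h1 | h1
  · rcases le_total p.2.natAbs (p.1 + p.2 - n).natAbs with h2 | h2
    · exact ⟨p.1 + p.2 - n, by simp, by omega, by omega, by omega, by omega⟩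
    · exact ⟨p.2, by simp, by omega, by omega, by omega, by omega⟩
  · rcases le_total p.1.natAbs (p.1 + p.2 - n).natAbs with h2 | h2
    · exact ⟨p.1 + p.2 - n, by simp, by omega, by omega, by omega, by omega⟩
    · exact ⟨p.1, by simp, by omega, by omega, by omega, by omega⟩

/-- Constant of the trilinear estimate for the Birkhoff vector field. -/
def birkhoffConst (α s : ℝ) : ℝ :=
  (ENNReal.ofReal (3 * √(9 ^ s)) * ∑' a, kernelProfile α a ^ 2).toReal

theorem exists_isSolOn_near_truncated {α σ s' s R ε δ : ℝ} (hα₁ : 3 / 4 < α) (hα₂ : α ≤ 1)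
    (hσ : |σ| = 1) (hs' : 2 - 2 * α ≤ s') (hss : s' < s) (hR : 0 < R) (hε : 0 < ε) (hδ : 0 < δ)
    (hδ1 : δ ≤ 1) {M N : ℕ} (hM : ∀ j : ℤ, M ≤ j.natAbs → japSq s' j ≤ δ ^ 2 * japSq s j)
    (hN : 3 * M ≤ N)
    (hsmall : 2 * δ * birkhoffConst α s * R ^ 3 *
      Real.exp (1 + birkhoffConst α s * (3 * (2 * R + ε) ^ 2)) ≤ ε)
    {V : ℝ → ℤ → ℂ} (hV : IsSolOn α σ (N : ℕ∞) s (Icc (-1 : ℝ) 1) V)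
    (hVR : ∀ t ∈ Icc (-1 : ℝ) 1, hsE s (V t) ≤ ENNReal.ofReal R) :
    ∃ U : ℝ → ℤ → ℂ, IsSolOn α σ ⊤ s (Icc (-1 : ℝ) 1) U ∧ U 0 = V 0 ∧
      ∀ t ∈ Icc (-1 : ℝ) 1, hsE s' (fun n => U t n - V t n) ≤ ENNReal.ofReal ε := by
  have hs0 : 0 ≤ s' := by linarith
  set ω := mixedWeight s' s δ with hω
  set W : ℤ → ℝ := fun n => √(japSq s n) with hWdef
  set K : ℝ := √(9 ^ s) with hKdef
  have hK : 0 ≤ K := Real.sqrt_nonneg _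
  have hω0 : ∀ j, 0 < ω j := mixedWeight_pos s' s δ
  have hW0 : ∀ j, 0 < W j := sqrt_japSq_pos s
  have hW : ∀ j : ℤ, max 1 |(j : ℝ)| ^ (2 - 2 * α) ≤ W j :=
    max_one_rpow_le_sqrt_japSq (by linarith)
  have hω1 : ∀ j : ℤ, max 1 |(j : ℝ)| ^ (2 - 2 * α) ≤ ω j := fun j =>
    (max_one_rpow_le_sqrt_japSq hs' j).trans (sqrt_japSq_le_mixedWeight j)
  have hωW : ∀ j, ω j ≤ 2 * W j := mixedWeight_le_two_mul hs0 hss.le hδ hδ1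
  have hωK : ∀ n j : ℤ, n.natAbs ≤ 3 * j.natAbs → ω n ≤ K * ω j := fun n j h =>
    mixedWeight_le_of_abs_le hs0 hss.le (by rw [Int.abs_eq_natAbs, Int.abs_eq_natAbs]; omega)
  have hωω : ∀ (n : ℤ) (p : ℤ × ℤ),
      ω n ≤ K * ω p.1 ∨ ω n ≤ K * ω p.2 ∨ ω n ≤ K * ω (p.1 + p.2 - n) := fun n p => by
    obtain ⟨j, hj, hnj, -⟩ := natAbs_le_three_mul n p
    have := hωK n j hnj
    rcases hj with rfl | rfl | rfl <;> simp [this]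
  have hC : ENNReal.ofReal (3 * K) ≠ ⊤ := ENNReal.ofReal_ne_top
  have hC' : ENNReal.ofReal (3 * (K * (2 * δ))) ≠ ⊤ := ENNReal.ofReal_ne_top
  have hh := tsum_kernelProfile_ne_top hα₁
  have hκ : KernelBound (weightedKernel ω ω (birkhoffKernel α σ ⊤)) (ENNReal.ofReal (3 * K))
      (kernelProfile α) :=
    kernelBound_weightedKernel hα₁ hα₂ hσ hK hω0 hω1 (fun _ _ => le_rfl) fun n p _ => hωω n p
  have hκN : KernelBound (weightedKernel ω ω (birkhoffKernel α σ N)) (ENNReal.ofReal (3 * K))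
      (kernelProfile α) :=
    kernelBound_weightedKernel hα₁ hα₂ hσ hK hω0 hω1 (abs_birkhoffKernel_le_top α σ N)
      fun n p _ => hωω n p
  have hκd : KernelBound (weightedKernel ω W fun n p =>
      birkhoffKernel α σ ⊤ n p - birkhoffKernel α σ N n p)
      (ENNReal.ofReal (3 * (K * (2 * δ)))) (kernelProfile α) := by
    refine kernelBound_weightedKernel hα₁ hα₂ hσ (by positivity) hω0 hW
      (abs_birkhoffKernel_sub_le_top α σ N) fun n p hne => ?_
    obtain ⟨j, hj, hnj, h1, h2, h3⟩ := natAbs_le_three_mul n p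
    have hMj : M ≤ j.natAbs := by
      by_contra! hlt
      refine hne (sub_eq_zero.2 (birkhoffKernel_eq_top α σ ?_ ?_ ?_ ?_).symm) <;>
      exact Nat.cast_le.2 (by omega)
    have := calc ω n ≤ K * ω j := hωK n j hnj
      _ ≤ K * (2 * δ * W j) := by gcongr; exact mixedWeight_le_mul_of_japSq_le hδ (hM j hMj)
      _ = K * (2 * δ) * W j := by ring
    rcases hj with rfl | rfl | rfl <;> simp [this]
  set B := birkhoffConst α s with hB
  have hB0 : 0 ≤ B := ENNReal.toReal_nonneg
  set v : ℝ → Ell2 := fun t => toEll2 fun n => ω n * V t n with hv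
  set v' : ℝ → Ell2 := fun t => toEll2 fun n => ω n * XB α σ N (V t) n with hv'
  have hva : ∀ t ∈ Icc (-1 : ℝ) 1, ∀ n, v t n = ω n * V t n := fun t ht n =>
    toEll2_apply (memℓp_weight_mul two_pos.le (fun n => (hω0 n).le) hωW (hV t ht).1) n
  have hva' : ∀ t ∈ Icc (-1 : ℝ) 1, ∀ n, v' t n = ω n * XB α σ N (V t) n := fun t ht n => by
    refine toEll2_apply ?_ n
    have := memℓp_triSum hC hh hκN (v t) (v t) (v t)
    convert this using 2 with n
    rw [triSum_weightedKernel hω0 _ (hva t ht), XB_eq_tsum]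
  have hdef : ∀ t ∈ Icc (-1 : ℝ) 1, ‖cubic hC hh hκ (v t) - v' t‖ ≤ 2 * δ * B * R ^ 3 := by
    intro t ht
    have hm : Memℓp (fun n => (W n : ℂ) * V t n) 2 :=
      memℓp_weight_mul zero_le_one (fun n => (hW0 n).le) (fun n => (one_mul (W n)).ge)
        (hV t ht).1
    set x : Ell2 := ⟨_, hm⟩ with hx
    have hxa : ∀ n, x n = W n * V t n := fun n => rfl
    have hxR : ‖x‖ ≤ R := by
      have := enorm_le_mul_hsE zero_le_one (fun n => (hW0 n).le)
        (fun n => (one_mul (W n)).ge) hxa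
      rw [ENNReal.ofReal_one, one_mul] at this
      have := this.trans (hVR t ht)
      rwa [← ofReal_norm, ENNReal.ofReal_le_ofReal_iff hR.le] at this
    have hcoe : ⇑(cubic hC hh hκ (v t) - v' t) = triSum (weightedKernel ω W fun n p =>
        birkhoffKernel α σ ⊤ n p - birkhoffKernel α σ N n p) x x x := by
      funext n
      have e1 : (cubic hC hh hκ (v t) - v' t) n =
          triSum (weightedKernel ω ω (birkhoffKernel α σ ⊤)) (v t) (v t) (v t) n - v' t n := rfl
      rw [e1, hva' t ht, triSum_weightedKernel hω0 _ (hva t ht), triSum_weightedKernel hW0 _ hxa,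
        XB_eq_tsum, ← mul_sub, ← Summable.tsum_sub
          (summable_of_summable_weightedKernel hω0 hω0 (hva t ht)
            (summable_triSum hC hh hκ (v t) (v t) (v t) n))
          (summable_of_summable_weightedKernel hω0 hω0 (hva t ht)
            (summable_triSum hC hh hκN (v t) (v t) (v t) n))]
      congr 1
      refine tsum_congr fun p => ?_
      push_cast
      ring
    refine (norm_triSum_le hC' hh hκd x x x _ hcoe).trans ?_
    have e2 : (ENNReal.ofReal (3 * (K * (2 * δ))) * ∑' a, kernelProfile α a ^ 2).toReal =
        2 * δ * B := by
      rw [hB, birkhoffConst, ENNReal.toReal_mul, ENNReal.toReal_mul,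
        ENNReal.toReal_ofReal (by positivity), ENNReal.toReal_ofReal (by positivity), ← hKdef]
      ring
    rw [e2, show R ^ 3 = R * R * R by ring]
    gcongr
  have hvR : ∀ t ∈ Icc (-1 : ℝ) 1, ‖v t‖ ≤ 2 * R := fun t ht => by
    have h1 := enorm_le_mul_hsE two_pos.le (fun n => (hω0 n).le) hωW (hva t ht)
    have h2 : ‖v t‖ₑ ≤ ENNReal.ofReal (2 * R) := by
      rw [ENNReal.ofReal_mul two_pos.le]
      exact h1.trans (by gcongr; exact hVR t ht)
    rwa [← ofReal_norm, ENNReal.ofReal_le_ofReal_iff (by positivity)] at h2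
  obtain ⟨u, hu0, hu⟩ := exists_solution_near (X := cubic hC hh hκ) (r := 2 * R) hε
    (K := 1 + B * (3 * (2 * R + ε) ^ 2)) (η := 2 * δ * B * R ^ 3)
    (le_add_of_nonneg_right (by positivity)) (by positivity)
    (fun x y hx hy => (norm_cubic_sub_le hC hh hκ hx hy).trans
      (mul_le_mul_of_nonneg_right (le_add_of_nonneg_left zero_le_one) (norm_nonneg _)))
    (fun t ht => (hV t ht).2.hasDerivWithinAt two_pos.le (fun n => (hω0 n).le) hωW ht hva
      (hva' t ht)) hvR hdef hsmall
  have hωne : ∀ n, (ω n : ℂ) ≠ 0 := fun n => Complex.ofReal_ne_zero.2 (hω0 n).ne'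
  set U : ℝ → ℤ → ℂ := fun t n => u t n / ω n with hU
  have hUu : ∀ t n, u t n = ω n * U t n := fun t n => (mul_div_cancel₀ _ (hωne n)).symm
  refine ⟨U, fun t ht => ⟨?_, ?_⟩, ?_, fun t ht => ?_⟩
  · refine ((hsE_le_mul_enorm (inv_nonneg.2 hδ.le) (fun n => (hω0 n).le)
      (sqrt_japSq_le_inv_mul_mixedWeight hδ) (hUu t)).trans_lt ?_).ne
    exact ENNReal.mul_lt_top ENNReal.ofReal_lt_top enorm_lt_top
  · refine (hu t ht).1.hasHsDerivWithinAt (inv_nonneg.2 hδ.le) (fun n => (hω0 n).le)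
      (sqrt_japSq_le_inv_mul_mixedWeight hδ) hUu fun n => ?_
    rw [XB_eq_tsum, ← triSum_weightedKernel hω0 _ (hUu t)]
    rfl
  · funext n
    simp only [hU, hu0]
    rw [hva 0 (by simp) n, mul_div_cancel_left₀ _ (hωne n)]
  · have h1 := hsE_le_mul_enorm (s := s') (x := u t - v t) (f := fun n => U t n - V t n)
      zero_le_one (fun n => (hω0 n).le)
      (fun n => (sqrt_japSq_le_mixedWeight n).trans_eq (one_mul _).symm) fun n => by
        have e1 : (u t - v t) n = u t n - v t n := rfl
        rw [e1, hUu, hva t ht]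
        ring
    rw [ENNReal.ofReal_one, one_mul, ← ofReal_norm] at h1
    exact h1.trans (ENNReal.ofReal_le_ofReal (hu t ht).2)

/-- Conditional global approximation: if the truncated flows exist on `[-1,1]` with a uniform
`H^s` bound `R` on `A`, then for `N` large the untruncated flow exists on `[-1,1]` on `A` and
is `ε`-close to the truncated one in `H^{s'}`. -/
theorem statement_13 (α : ℝ) (hα₁ : 3/4 < α) (hα₂ : α ≤ 1) (s' s : ℝ)
    (hs' : 2 - 2*α ≤ s') (hss : s' < s) (R ε : ℝ) (hR : 0 < R) (hε : 0 < ε) :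
    ∃ N₀ : ℕ, ∀ σ : ℝ, (σ = 1 ∨ σ = -1) →
      ∀ A : Set (ℤ → ℂ), (∀ u ∈ A, hsE s u ≤ ENNReal.ofReal R) →
      ∀ N : ℕ, N₀ ≤ N →
      ∀ V : (ℤ → ℂ) → ℝ → ℤ → ℂ,
        (∀ u₀ ∈ A, IsSolOn α σ (N : ℕ∞) s (Set.Icc (-1 : ℝ) 1) (V u₀) ∧ V u₀ 0 = u₀ ∧
          ∀ t ∈ Set.Icc (-1 : ℝ) 1, hsE s (V u₀ t) ≤ ENNReal.ofReal R) →
        ∀ u₀ ∈ A, ∃ U : ℝ → ℤ → ℂ,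
          IsSolOn α σ ⊤ s (Set.Icc (-1 : ℝ) 1) U ∧ U 0 = u₀ ∧
          ∀ t ∈ Set.Icc (-1 : ℝ) 1,
            hsE s' (fun n => U t n - V u₀ t n) ≤ ENNReal.ofReal ε := by
  have hs0 : 0 ≤ s' := by linarith
  set B := birkhoffConst α s with hB
  have hB0 : 0 ≤ B := ENNReal.toReal_nonneg
  set c := 2 * B * R ^ 3 * Real.exp (1 + B * (3 * (2 * R + ε) ^ 2)) with hc
  have hc0 : 0 ≤ c := by positivity
  set δ := min 1 (ε / (c + 1)) with hδdef
  have hδ : 0 < δ := by positivity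
  obtain ⟨M, hM⟩ := exists_forall_japSq_le hs0 hss hδ
  refine ⟨3 * M, fun σ hσ A _ N hN V hV u₀ hu₀ => ?_⟩
  obtain ⟨hsol, h0, hVR⟩ := hV u₀ hu₀
  have hσ1 : |σ| = 1 := by rcases hσ with rfl | rfl <;> simp
  have hsmall : 2 * δ * B * R ^ 3 * Real.exp (1 + B * (3 * (2 * R + ε) ^ 2)) ≤ ε :=
    calc 2 * δ * B * R ^ 3 * Real.exp (1 + B * (3 * (2 * R + ε) ^ 2)) = δ * c := by
          rw [hc]; ring
      _ ≤ ε / (c + 1) * (c + 1) :=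
          mul_le_mul (min_le_right _ _) (by linarith) hc0 (by positivity)
      _ = ε := div_mul_cancel₀ _ (by positivity)
  obtain ⟨U, hU, hU0, hUV⟩ := exists_isSolOn_near_truncated hα₁ hα₂ hσ1 hs' hss hR hε hδ
    (min_le_left _ _) hM hN hsmall hsol hVR
  exact ⟨U, hU, hU0.trans h0, hUV⟩

end
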